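/- Let n ≥ 2 and let c be a self-conjugate 2n-core, so φ_{2n}(c) = (m_0,…,m_{n−1}, −m_{n−1},…,−m_0). Set c′ := φ_{2n+2}^{-1}(0, m_0,…,m_{n−1}, 0, −m_{n−1},…,−m_0). Then c′ is a doubled distinct (2n+2)-core, and there exists a (unique) distinct partition λ̄ ∈ 𝒞_{2n+2}^{d,r} with c′ = λ̄λ̄. Moreover the map c ↦ λ̄ so obtained is a bijection from 𝒞_{2n}^s to 𝒞_{2n+2}^{d,r}, and |λ̄| = (n+1) Σ_{i=0}^{n−1} m_i² + Σ_{i=0}^{n−1} (i − n) m_i = (1/2)(|c| + a_0(c) + a_n(c)), where a_r(c) denotes the number of boxes of c whose residue modulo 2n equals r. -/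

import Mathlib

open scoped Classical

/-- `p k` is the `(k+1)`-st part `λ_{k+1}` of the partition `λ` :
partitions are encoded by their (eventually zero, antitone) sequence of parts. -/
def IsPartition (p : ℕ → ℕ) : Prop :=
  Antitone p ∧ ∃ N, ∀ i, N ≤ i → p i = 0

/-- The number of (nonzero) parts of a partition. -/
noncomputable def plen (p : ℕ → ℕ) : ℕ := Nat.card {i : ℕ // p i ≠ 0}

/-- The number of boxes `|λ|` of a partition. -/
noncomputable def psize (p : ℕ → ℕ) : ℕ := ∑ i ∈ Finset.range (plen p), p i

/-- The conjugate partition : `pconj p j = λ^tr_{j+1}`. -/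
noncomputable def pconj (p : ℕ → ℕ) (j : ℕ) : ℕ := Nat.card {i : ℕ // j + 1 ≤ p i}

/-- The size of the Durfee square of a partition. -/
noncomputable def durfee (p : ℕ → ℕ) : ℕ := Nat.card {i : ℕ // i + 1 ≤ p i}

/-- The cells (boxes) of the Young diagram, `0`-indexed : `(i, j)` is the box in
row `i+1` and column `j+1`. -/
noncomputable def cells (p : ℕ → ℕ) : Finset (ℕ × ℕ) :=
  (Finset.range (plen p) ×ˢ Finset.range (p 0)).filter fun s => s.2 < p s.1

/-- The hook length of the (0-indexed) box `(i, j)` :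
`h = λ_{i+1} - (j+1) + λ^tr_{j+1} - (i+1) + 1`. -/
noncomputable def hookLen (p : ℕ → ℕ) (i j : ℕ) : ℕ :=
  (p i - j) + (pconj p j - i) - 1

/-- The multiset of hook lengths `ℋ(λ)`. -/
noncomputable def hooks (p : ℕ → ℕ) : Multiset ℕ :=
  (cells p).val.map fun s => hookLen p s.1 s.2

/-- The multiset of hook lengths of the boxes strictly above the main diagonal. -/
noncomputable def hooksAbove (p : ℕ → ℕ) : Multiset ℕ :=
  ((cells p).filter fun s => s.1 < s.2).val.map fun s => hookLen p s.1 s.2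

/-- The multiset of hook lengths of the boxes strictly below the main diagonal. -/
noncomputable def hooksBelow (p : ℕ → ℕ) : Multiset ℕ :=
  ((cells p).filter fun s => s.2 < s.1).val.map fun s => hookLen p s.1 s.2

/-- `p` is an `n`-core : no hook length is equal to `n`. -/
def IsCore (n : ℕ) (p : ℕ → ℕ) : Prop := n ∉ hooks p

/-- Self-conjugate partitions. -/
def SelfConj (p : ℕ → ℕ) : Prop := p = pconj p

/-- Distinct partitions (strictly decreasing nonzero parts). -/
def IsDistinct (p : ℕ → ℕ) : Prop := ∀ i, p (i + 1) ≠ 0 → p (i + 1) < p i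

/-- Doubled distinct partitions : `λ_i = λ^tr_i + 1` for `i` at most
the size of the Durfee square. -/
def IsDD (p : ℕ → ℕ) : Prop := ∀ i < durfee p, p i = pconj p i + 1

/-- Conjugates of doubled distinct partitions. -/
def IsDDtr (p : ℕ → ℕ) : Prop := ∃ q, IsPartition q ∧ IsDD q ∧ p = pconj q

/-- The doubled distinct partition `λ̄λ̄` of a distinct partition `λ̄` :
add `λ̄_i` boxes to the `i`-th column of the shifted Young diagram of `λ̄`. -/
noncomputable def double (b : ℕ → ℕ) : ℕ → ℕ := fun i =>
  if i < plen b then b i + (i + 1)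
  else Nat.card {j : ℕ // j < plen b ∧ i + 1 ≤ b j + j}

/-- The self-conjugate partition associated with a distinct partition `λ̄` :
add `λ̄_i - 1` boxes to the `i`-th column of the shifted Young diagram of `λ̄`. -/
noncomputable def scOf (b : ℕ → ℕ) : ℕ → ℕ := fun i =>
  if i < plen b then b i + i
  else Nat.card {j : ℕ // j < plen b ∧ i + 1 ≤ b j + j}

/-- The binary word `ψ(λ) = (c_k)_{k ∈ ℤ}` of a partition :
`c_k = 0` iff `k ∈ {λ_i - i : i ≥ 1}` and `c_k = 1` otherwise
(i.e. iff `k ∈ {j - λ^tr_j - 1 : j ≥ 1}`). -/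
noncomputable def word (p : ℕ → ℕ) (k : ℤ) : ℕ :=
  if ∃ m : ℕ, k = (p m : ℤ) - ((m : ℤ) + 1) then 0 else 1

/-- The `g`-charge of a `g`-core : `m_i = min {k ∈ ℤ : c_{kg+i} = 1}`. -/
noncomputable def ncharge (g : ℕ) (p : ℕ → ℕ) (i : ℕ) : ℤ :=
  sInf {k : ℤ | word p (k * (g : ℤ) + (i : ℤ)) = 1}

/-- The subword of residue `k` modulo `g` of the word of `p`. -/
noncomputable def subword (g k : ℕ) (p : ℕ → ℕ) (i : ℤ) : ℕ :=
  word p ((g : ℤ) * i + (k : ℤ))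

/-- The shift turning the subword of residue `k` into a balanced partition word. -/
noncomputable def qcharge (g : ℕ) (p : ℕ → ℕ) (k : ℕ) : ℤ :=
  (Nat.card {i : ℕ // subword g k p (i : ℤ) = 0} : ℤ) -
    (Nat.card {i : ℕ // subword g k p (-((i : ℤ) + 1)) = 1} : ℤ)

/-- `ν` is the `k`-th component of the `g`-quotient of `p` : its word is the
subword of residue `k` of the word of `p`, reindexed so as to be balanced. -/
def IsQuotientAt (g : ℕ) (p : ℕ → ℕ) (k : ℕ) (ν : ℕ → ℕ) : Prop :=
  ∀ i : ℤ, word ν i = subword g k p (i + qcharge g p k)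

/-- `ω` is the `g`-core of `p` : every subword of its word is sorted
(all `0`'s, then all `1`'s), with transition index the charge of `p`. -/
def IsCoreOf (g : ℕ) (p ω : ℕ → ℕ) : Prop :=
  ∀ k < g, ∀ i : ℤ, (subword g k ω i = 1 ↔ qcharge g p k ≤ i)

/-- `(ω, ν)` is the Littlewood decomposition of `p` for the modulus `g`. -/
def IsLittlewood (g : ℕ) (p ω : ℕ → ℕ) (ν : ℕ → ℕ → ℕ) : Prop :=
  IsCoreOf g p ω ∧ ∀ k < g, IsQuotientAt g p k (ν k)

/-- The number `a_r` of boxes of residue `r` modulo `g`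
(the residue of the box `(i, j)` -- `0`-indexed -- being `(j - i) mod g`). -/
noncomputable def resCount (g : ℕ) (p : ℕ → ℕ) (r : ℕ) : ℕ :=
  ((cells p).filter fun s => ((s.2 : ℤ) - (s.1 : ℤ)) % (g : ℤ) = (r : ℤ)).card

/-- The rectangular partition with `r` rows of length `c`. -/
def rect (r c : ℕ) : ℕ → ℕ := fun i => if i < r then c else 0

/-- The statistic `m = max({1} ∪ {(g + λ̄_i)/g : λ̄_i ≡ 0 (mod g)})`. -/
noncomputable def mStat (g : ℕ) (b : ℕ → ℕ) : ℕ :=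
  sSup ({1} ∪ {k : ℕ | ∃ i < plen b, g ∣ b i ∧ k = (g + b i) / g})

/-- The statistic `m' = max({0} ∪ {λ̄_i/g : λ̄_i ≡ g/2 (mod g)})`. -/
noncomputable def mStat' (g : ℕ) (b : ℕ → ℕ) : ℕ :=
  sSup ({0} ∪ {k : ℕ | ∃ i < plen b, 2 * (b i % g) = g ∧ k = b i / g})

/-- The vector `(0, m_0, …, m_{n-1}, 0, -m_{n-1}, …, -m_0)` of length `2n + 2`. -/
noncomputable def extVecD (n : ℕ) (m : ℕ → ℤ) : ℕ → ℤ := fun i =>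
  if i = 0 then 0
  else if i ≤ n then m (i - 1)
  else if i = n + 1 then 0
  else if i ≤ 2 * n + 1 then - m (2 * n + 1 - i)
  else 0

/-! ### Down-closed predicates, partitions and conjugates -/

lemma lt_card_iff {P : ℕ → Prop} (hP : ∀ i j, i ≤ j → P j → P i) {N : ℕ}
    (hN : ∀ i, P i → i < N) (i : ℕ) : i < Nat.card {j : ℕ // P j} ↔ P i := by
  have hex : ∃ d, ¬ P d := ⟨N, fun h => lt_irrefl _ (hN N h)⟩
  have hd : ∀ j, P j ↔ j < Nat.find hex := fun j =>
    ⟨fun h => by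
      by_contra hlt
      exact Nat.find_spec hex (hP _ _ (not_lt.1 hlt) h),
     fun h => not_not.1 (Nat.find_min hex h)⟩
  generalize Nat.find hex = d at hd
  have hcard : Nat.card {j : ℕ // P j} = d := by
    rw [Nat.card_congr (Equiv.subtypeEquivRight hd),
      Nat.card_congr (Fin.equivSubtype (n := d)).symm, Nat.card_fin]
  rw [hcard, hd]

lemma lt_plen_iff {p : ℕ → ℕ} (hp : IsPartition p) (i : ℕ) : i < plen p ↔ p i ≠ 0 := by
  obtain ⟨ha, N, hN⟩ := hp
  refine lt_card_iff (P := fun i => p i ≠ 0) (N := N) (fun i j hij hj => ?_) (fun i hi => ?_) i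
  · have := ha hij
    omega
  · by_contra h
    exact hi (hN i (not_lt.1 h))

lemma lt_pconj_iff {p : ℕ → ℕ} (hp : IsPartition p) (i j : ℕ) : i < pconj p j ↔ j < p i := by
  obtain ⟨ha, N, hN⟩ := hp
  refine lt_card_iff (P := fun i => j + 1 ≤ p i) (N := N) (fun i j hij hj => ?_)
    (fun i hi => ?_) i
  · have := ha hij
    omega
  · by_contra h
    have := hN i (not_lt.1 h)
    omega

lemma lt_durfee_iff {p : ℕ → ℕ} (hp : IsPartition p) (i : ℕ) : i < durfee p ↔ i < p i := by
  obtain ⟨ha, N, hN⟩ := hp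
  refine lt_card_iff (P := fun i => i + 1 ≤ p i) (N := N) (fun i j hij hj => ?_)
    (fun i hi => ?_) i
  · have := ha hij
    omega
  · by_contra h
    have := hN i (not_lt.1 h)
    omega

lemma IsPartition.pconj {p : ℕ → ℕ} (hp : IsPartition p) : IsPartition (pconj p) := by
  refine ⟨fun i j hij => ?_, p 0, fun j hj => ?_⟩
  · by_contra! h
    have h1 := (lt_pconj_iff hp _ _).1 h
    exact lt_irrefl _ ((lt_pconj_iff hp (_root_.pconj p i) i).2 (by omega))
  · by_contra h
    have := (lt_pconj_iff hp 0 j).1 (Nat.pos_of_ne_zero h)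
    omega

lemma mem_cells_iff {p : ℕ → ℕ} (hp : IsPartition p) (s : ℕ × ℕ) :
    s ∈ cells p ↔ s.2 < p s.1 := by
  have h0 := hp.1 (Nat.zero_le s.1)
  have := lt_plen_iff hp s.1
  simp only [cells, Finset.mem_filter, Finset.mem_product, Finset.mem_range, this]
  omega

/-! ### The zeros of the binary word -/

/-- The positions of the letters `0` in the binary word of `p`. -/
def zeros (p : ℕ → ℕ) : Set ℤ := {x | ∃ m : ℕ, x = (p m : ℤ) - ((m : ℤ) + 1)}

lemma word_eq_one_iff (p : ℕ → ℕ) (x : ℤ) : word p x = 1 ↔ x ∉ zeros p := by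
  simp [word, zeros]

lemma zeros_injective {p q : ℕ → ℕ} (hp : IsPartition p) (hq : IsPartition q)
    (h : zeros p = zeros q) : p = q := by
  have key : ∀ r : ℕ → ℕ, IsPartition r →
      StrictMono (fun m : ℕ => -((r m : ℤ) - ((m : ℤ) + 1))) := fun r hr =>
    strictMono_nat_of_lt_succ fun m => by
      have := hr.1 (Nat.le_succ m)
      simp only [Nat.succ_eq_add_one] at this
      push_cast
      omega
  have hr : Set.range (fun m : ℕ => -((p m : ℤ) - ((m : ℤ) + 1))) =
      Set.range (fun m : ℕ => -((q m : ℤ) - ((m : ℤ) + 1))) := by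
    ext x
    have := Set.ext_iff.1 h (-x)
    simp only [zeros, Set.mem_ofPred_eq] at this
    simp only [Set.mem_range]
    constructor
    · rintro ⟨m, hm⟩
      obtain ⟨m', hm'⟩ := this.1 ⟨m, by omega⟩
      exact ⟨m', by omega⟩
    · rintro ⟨m, hm⟩
      obtain ⟨m', hm'⟩ := this.2 ⟨m, by omega⟩
      exact ⟨m', by omega⟩
  have := ((key p hp).range_inj (key q hq)).1 hr
  funext m
  have := congrFun this m
  omega

lemma notMem_zeros_iff {p : ℕ → ℕ} (hp : IsPartition p) (x : ℤ) :
    x ∉ zeros p ↔ ∃ j : ℕ, x = (j : ℤ) - (pconj p j : ℤ) := by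
  constructor
  · intro hx
    have hex : ∃ i : ℕ, (p i : ℤ) - ((i : ℤ) + 1) < x := by
      obtain ⟨N, hN⟩ := hp.2
      refine ⟨N + x.natAbs, ?_⟩
      rw [hN _ (by omega)]
      omega
    obtain ⟨i, hi, hmin⟩ : ∃ i : ℕ, (p i : ℤ) - ((i : ℤ) + 1) < x ∧
        ∀ k < i, ¬ (p k : ℤ) - ((k : ℤ) + 1) < x :=
      ⟨Nat.find hex, Nat.find_spec hex, fun k hk => Nat.find_min hex hk⟩
    refine ⟨(x + i).toNat, ?_⟩
    have h1 : ¬ i < pconj p (x + i).toNat := by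
      rw [lt_pconj_iff hp]
      omega
    have h2 : ∀ k < i, k < pconj p (x + i).toNat := by
      intro k hk
      rw [lt_pconj_iff hp]
      have h3 := hmin (i - 1) (by omega)
      have h4 : (p (i - 1) : ℤ) - (((i - 1 : ℕ) : ℤ) + 1) ≠ x := fun h => hx ⟨_, h.symm⟩
      have h5 := hp.1 (show k ≤ i - 1 by omega)
      omega
    have h3 : i ≤ pconj p (x + i).toNat := by
      rcases Nat.eq_zero_or_pos i with h | h
      · omega
      · have := h2 (i - 1) (by omega)
        omega
    omega
  · rintro ⟨j, rfl⟩ ⟨i, hi⟩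
    have := lt_pconj_iff hp i j
    by_cases h : j < p i
    · have := this.2 h
      omega
    · have := fun h' => h (this.1 h')
      omega

lemma mem_zeros_pconj_iff {p : ℕ → ℕ} (hp : IsPartition p) (x : ℤ) :
    x ∈ zeros (pconj p) ↔ -1 - x ∉ zeros p := by
  rw [notMem_zeros_iff hp]
  constructor
  · rintro ⟨m, hm⟩
    exact ⟨m, by omega⟩
  · rintro ⟨m, hm⟩
    exact ⟨m, by omega⟩

lemma selfConj_iff {p : ℕ → ℕ} (hp : IsPartition p) :
    SelfConj p ↔ ∀ x, x ∈ zeros p ↔ -1 - x ∉ zeros p := by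
  constructor
  · intro h x
    rw [← mem_zeros_pconj_iff hp, ← h]
  · intro h
    refine zeros_injective hp hp.pconj (Set.ext fun x => ?_)
    rw [h, mem_zeros_pconj_iff hp]

lemma exists_forall_lt_mem_zeros {p : ℕ → ℕ} (hp : IsPartition p) :
    ∃ a : ℤ, ∀ x < a, x ∈ zeros p := by
  obtain ⟨N, hN⟩ := hp.2
  refine ⟨-N, fun x hx => ⟨(-x - 1).toNat, ?_⟩⟩
  rw [hN _ (by omega)]
  omega

lemma lt_of_mem_zeros {p : ℕ → ℕ} (hp : IsPartition p) {x : ℤ} (hx : x ∈ zeros p) :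
    x < p 0 := by
  obtain ⟨m, rfl⟩ := hx
  have := hp.1 (Nat.zero_le m)
  omega

/-! ### Hook lengths and cores -/

lemma hookLen_eq {p : ℕ → ℕ} (hp : IsPartition p) {i j : ℕ} (h : j < p i) :
    (hookLen p i j : ℤ) = ((p i : ℤ) - ((i : ℤ) + 1)) - ((j : ℤ) - (pconj p j : ℤ)) := by
  have := (lt_pconj_iff hp i j).2 h
  unfold hookLen
  omega

lemma lt_of_zero_gt_one {p : ℕ → ℕ} (hp : IsPartition p) {i j : ℕ}
    (h : (j : ℤ) - (pconj p j : ℤ) < (p i : ℤ) - ((i : ℤ) + 1)) : j < p i := by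
  have := lt_pconj_iff hp i j
  by_contra h'
  have := fun h'' => h' (this.1 h'')
  omega

lemma isCore_iff {g : ℕ} (hg : 0 < g) {p : ℕ → ℕ} (hp : IsPartition p) :
    IsCore g p ↔ ∀ x ∈ zeros p, x - g ∈ zeros p := by
  simp only [IsCore, hooks, Multiset.mem_map, Finset.mem_val, mem_cells_iff hp, not_exists,
    not_and]
  constructor
  · rintro h x ⟨i, rfl⟩
    by_contra hx
    obtain ⟨j, hj⟩ := (notMem_zeros_iff hp _).1 hx
    have hlt := lt_of_zero_gt_one hp (i := i) (j := j) (by omega)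
    refine h (i, j) hlt ?_
    have := hookLen_eq hp hlt
    simp only
    omega
  · rintro h ⟨i, j⟩ hlt hh
    change j < p i at hlt
    change hookLen p i j = g at hh
    have := hookLen_eq hp hlt
    refine (notMem_zeros_iff hp _).2 ⟨j, rfl⟩ ?_
    have := h _ ⟨i, rfl⟩
    convert this using 1
    omega

lemma mem_hooksAbove_iff {g : ℕ} {p : ℕ → ℕ} (hp : IsPartition p) :
    g ∈ hooksAbove p ↔ ∃ i j, i < j ∧ j < p i ∧ hookLen p i j = g := by
  simp only [hooksAbove, Multiset.mem_map, Finset.mem_val, Finset.mem_filter, mem_cells_iff hp,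
    Prod.exists]
  constructor
  · rintro ⟨i, j, ⟨h1, h2⟩, h3⟩
    exact ⟨i, j, h2, h1, h3⟩
  · rintro ⟨i, j, h2, h1, h3⟩
    exact ⟨i, j, ⟨h1, h2⟩, h3⟩

lemma IsCore.notMem_hooksAbove {g : ℕ} {p : ℕ → ℕ} (h : IsCore g p) : g ∉ hooksAbove p := by
  intro h'
  simp only [hooksAbove, Multiset.mem_map, Finset.mem_val, Finset.mem_filter] at h'
  obtain ⟨s, ⟨hs, -⟩, rfl⟩ := h'
  exact h (Multiset.mem_map_of_mem _ hs)

lemma IsCore.sub_mul_mem {g : ℕ} (hg : 0 < g) {p : ℕ → ℕ} (hp : IsPartition p)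
    (hc : IsCore g p) {x : ℤ} (hx : x ∈ zeros p) (t : ℕ) : x - t * g ∈ zeros p := by
  rw [isCore_iff hg hp] at hc
  induction t with
  | zero => simpa
  | succ t ih =>
    convert hc _ ih using 1
    push_cast
    ring

/-! ### The charge -/

lemma ncharge_eq_of_forall {g : ℕ} {p : ℕ → ℕ} {i : ℕ} {M : ℤ}
    (h : ∀ k : ℤ, k * g + i ∈ zeros p ↔ k < M) : ncharge g p i = M := by
  have : {k : ℤ | word p (k * (g : ℤ) + (i : ℤ)) = 1} = Set.Ici M := by
    ext k
    simp [word_eq_one_iff, h]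
  rw [ncharge, this, csInf_Ici]

lemma mem_zeros_iff_lt_ncharge {g : ℕ} (hg : 0 < g) {p : ℕ → ℕ} (hp : IsPartition p)
    (hc : IsCore g p) (i : ℕ) (k : ℤ) : k * g + i ∈ zeros p ↔ k < ncharge g p i := by
  have hg' : (1 : ℤ) ≤ g := by exact_mod_cast hg
  set A : Set ℤ := {k : ℤ | word p (k * (g : ℤ) + (i : ℤ)) = 1} with hA
  have hmem : ∀ k, k ∈ A ↔ k * g + i ∉ zeros p := fun k => by simp [hA, word_eq_one_iff]
  have hne : A.Nonempty := by
    refine ⟨p 0, (hmem _).2 fun h => ?_⟩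
    have := lt_of_mem_zeros hp h
    nlinarith [Int.natCast_nonneg (p 0), Int.natCast_nonneg i]
  have hbdd : BddBelow A := by
    obtain ⟨a, ha⟩ := exists_forall_lt_mem_zeros hp
    refine ⟨-|a| - i, fun k hk => ?_⟩
    by_contra! hlt
    refine (hmem k).1 hk (ha _ ?_)
    have := neg_abs_le a
    have := abs_nonneg a
    nlinarith [Int.natCast_nonneg i]
  have hs := Int.csInf_mem hne hbdd
  have hch : ncharge g p i = sInf A := rfl
  rw [hch]
  constructor
  · intro hk
    by_contra! hle
    refine (hmem _).1 hs ?_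
    have := hc.sub_mul_mem hg hp hk (k - sInf A).toNat
    rw [Int.toNat_of_nonneg (by omega)] at this
    convert this using 1
    ring
  · intro hk
    by_contra h
    have := csInf_le hbdd ((hmem k).2 h)
    omega

lemma eq_of_ncharge_eq {g : ℕ} (hg : 0 < g) {p q : ℕ → ℕ} (hp : IsPartition p)
    (hq : IsPartition q) (hpc : IsCore g p) (hqc : IsCore g q)
    (h : ∀ i < g, ncharge g p i = ncharge g q i) : p = q := by
  refine zeros_injective hp hq (Set.ext fun x => ?_)
  have hg' : (0 : ℤ) < g := by exact_mod_cast hg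
  have h0 := Int.emod_nonneg x hg'.ne'
  have h1 := Int.emod_lt_of_pos x hg'
  have hx : x = x / g * g + ((x % g).toNat : ℕ) := by
    rw [Int.toNat_of_nonneg h0]
    linarith [Int.mul_ediv_add_emod x g]
  rw [hx, mem_zeros_iff_lt_ncharge hg hp hpc, mem_zeros_iff_lt_ncharge hg hq hqc, h _ (by omega)]

lemma ncharge_reflect {g : ℕ} {p : ℕ → ℕ} (hp : IsPartition p)
    (hc : IsCore g p) (hs : SelfConj p) {i : ℕ} (hi : i < g) :
    ncharge g p (g - 1 - i) = - ncharge g p i := by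
  refine ncharge_eq_of_forall fun k => ?_
  rw [(selfConj_iff hp).1 hs]
  have : -1 - (k * g + ((g - 1 - i : ℕ) : ℤ)) = (-k - 1) * g + i := by
    have : ((g - 1 - i : ℕ) : ℤ) = g - 1 - i := by omega
    rw [this]
    ring
  rw [this, mem_zeros_iff_lt_ncharge (by omega) hp hc]
  omega

/-! ### Partitions obtained by doubling a distinct partition -/

/-- The common form of `scOf` (`e = 0`) and `double` (`e = 1`). -/
noncomputable def shiftDouble (e : ℕ) (b : ℕ → ℕ) : ℕ → ℕ := fun i =>
  if i < plen b then b i + i + e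
  else Nat.card {j : ℕ // j < plen b ∧ i + 1 ≤ b j + j}

lemma double_eq_shiftDouble (b : ℕ → ℕ) : double b = shiftDouble 1 b := rfl

lemma scOf_eq_shiftDouble (b : ℕ → ℕ) : scOf b = shiftDouble 0 b := rfl

section Doubling

variable {b : ℕ → ℕ}

lemma IsDistinct.add_le_add (hd : IsDistinct b) {i j : ℕ} (hij : i ≤ j)
    (hj : b j ≠ 0) : b j + j ≤ b i + i := by
  induction j, hij using Nat.le_induction with
  | base => exact le_rfl
  | succ j hij ih =>
    have h1 := hd j hj
    have h2 := ih (by omega)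
    omega

lemma lt_tail_iff (hb : IsPartition b) (hd : IsDistinct b) (i j : ℕ) :
    j < Nat.card {j : ℕ // j < plen b ∧ i + 1 ≤ b j + j} ↔ j < plen b ∧ i + 1 ≤ b j + j := by
  refine lt_card_iff (P := fun j => j < plen b ∧ i + 1 ≤ b j + j) (N := plen b)
    (fun k j hkj hj => ?_) (fun j hj => hj.1) j
  have := hd.add_le_add hkj ((lt_plen_iff hb j).1 hj.1)
  omega

lemma tail_le_plen (hb : IsPartition b) (hd : IsDistinct b) (i : ℕ) :
    Nat.card {j : ℕ // j < plen b ∧ i + 1 ≤ b j + j} ≤ plen b := by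
  by_contra! h
  exact lt_irrefl _ ((lt_tail_iff hb hd i _).1 h).1

lemma isPartition_shiftDouble (e : ℕ) (hb : IsPartition b) (hd : IsDistinct b) :
    IsPartition (shiftDouble e b) := by
  refine ⟨antitone_nat_of_succ_le fun i => ?_, plen b + b 0, fun i hi => ?_⟩
  · unfold shiftDouble
    by_cases h1 : i + 1 < plen b
    · rw [if_pos h1, if_pos (by omega)]
      have := hd i ((lt_plen_iff hb _).1 h1)
      omega
    · rw [if_neg h1]
      by_cases h2 : i < plen b
      · rw [if_pos h2]
        have := tail_le_plen hb hd (i + 1)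
        have := (lt_plen_iff hb _).1 h2
        omega
      · rw [if_neg h2]
        by_contra! h
        have h3 := (lt_tail_iff hb hd _ _).1 h
        exact lt_irrefl _ ((lt_tail_iff hb hd i _).2 ⟨h3.1, by omega⟩)
  · unfold shiftDouble
    rw [if_neg (by omega)]
    by_contra h
    have := (lt_tail_iff hb hd i 0).1 (Nat.pos_of_ne_zero h)
    omega

lemma mem_zeros_shiftDouble_iff (e : ℕ) (hb : IsPartition b) (hd : IsDistinct b) (x : ℤ) :
    x ∈ zeros (shiftDouble e b) ↔
      (∃ i < plen b, x = (b i : ℤ) + e - 1) ∨ (x < 0 ∧ ∀ i, (b i : ℤ) ≠ -x) := by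
  constructor
  · rintro ⟨i, hi⟩
    unfold shiftDouble at hi
    by_cases h : i < plen b
    · rw [if_pos h] at hi
      left
      refine ⟨i, h, ?_⟩
      push_cast at hi
      omega
    · rw [if_neg h] at hi
      right
      have h1 := tail_le_plen hb hd i
      have h2 := lt_tail_iff hb hd i
      generalize Nat.card {j : ℕ // j < plen b ∧ i + 1 ≤ b j + j} = a at hi h1 h2
      refine ⟨by omega, fun j hj => ?_⟩
      have h3 := h2 j
      have h4 := lt_plen_iff hb j
      omega
  · rintro (⟨i, hi, rfl⟩ | ⟨hx, hne⟩)
    · refine ⟨i, ?_⟩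
      unfold shiftDouble
      rw [if_pos hi]
      push_cast
      ring
    · obtain ⟨z, hz⟩ : ∃ z : ℕ, x = -z := ⟨(-x).toNat, by omega⟩
      subst hz
      have hlt : ∀ j, j < Nat.card {j : ℕ // z < b j} ↔ z < b j :=
        lt_card_iff (P := fun j => z < b j) (N := plen b)
          (fun i j hij hj => lt_of_lt_of_le hj (hb.1 hij))
          (fun i hi => (lt_plen_iff hb i).2 (by omega))
      generalize Nat.card {j : ℕ // z < b j} = a at hlt
      have ha1 := hlt a
      have ha2 := hne a
      have hlen : ¬ a + z - 1 < plen b := by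
        intro h
        have h1 := (lt_plen_iff hb _).1 h
        have h2 := hd.add_le_add (show a ≤ a + z - 1 by omega) h1
        omega
      refine ⟨a + z - 1, ?_⟩
      unfold shiftDouble
      rw [if_neg hlen]
      have h2 := lt_tail_iff hb hd (a + z - 1)
      have h3 := tail_le_plen hb hd (a + z - 1)
      generalize Nat.card {j : ℕ // j < plen b ∧ a + z - 1 + 1 ≤ b j + j} = t at h2 h3
      have hta : t ≤ a := by
        by_contra! h
        obtain ⟨h4, h5⟩ := (h2 a).1 h
        omega
      have hat : a ≤ t := by
        by_contra! h
        have h4 := (hlt t).1 h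
        have h5 := (hlt (a - 1)).1 (by omega)
        have h6 := hd.add_le_add (show t ≤ a - 1 by omega) (by omega)
        have h7 := (lt_plen_iff hb t).2 (by omega)
        exact lt_irrefl _ ((h2 t).2 ⟨h7, by omega⟩)
      omega

lemma isPartition_double (hb : IsPartition b) (hd : IsDistinct b) : IsPartition (double b) :=
  isPartition_shiftDouble 1 hb hd

/-- The positive zeros of the word of `double b` are the parts of `b`, and the word is
antisymmetric away from the position `0`, which carries a `1`. -/
lemma mem_zeros_double_iff (hb : IsPartition b) (hd : IsDistinct b) (x : ℤ) :
    x ∈ zeros (double b) ↔ (0 < x ∧ ∃ i, (b i : ℤ) = x) ∨ (x < 0 ∧ ∀ i, (b i : ℤ) ≠ -x) := by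
  rw [double_eq_shiftDouble, mem_zeros_shiftDouble_iff 1 hb hd]
  refine or_congr_left ⟨?_, ?_⟩
  · rintro ⟨i, hi, rfl⟩
    have := (lt_plen_iff hb _).1 hi
    exact ⟨by push_cast; omega, i, by push_cast; omega⟩
  · rintro ⟨hx, i, rfl⟩
    exact ⟨i, (lt_plen_iff hb i).2 (by omega), by push_cast; omega⟩

lemma mem_zeros_scOf_iff (hb : IsPartition b) (hd : IsDistinct b) (x : ℤ) :
    x ∈ zeros (scOf b) ↔
      (0 ≤ x ∧ ∃ i, (b i : ℤ) = x + 1) ∨ (x < 0 ∧ ∀ i, (b i : ℤ) ≠ -x) := by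
  rw [scOf_eq_shiftDouble, mem_zeros_shiftDouble_iff 0 hb hd]
  refine or_congr_left ⟨?_, ?_⟩
  · rintro ⟨i, hi, rfl⟩
    have := (lt_plen_iff hb _).1 hi
    exact ⟨by push_cast; omega, i, by push_cast; omega⟩
  · rintro ⟨hx, i, hi⟩
    exact ⟨i, (lt_plen_iff hb i).2 (by omega), by push_cast; omega⟩

lemma lt_double_iff (hb : IsPartition b) (hd : IsDistinct b) (i : ℕ) :
    i < double b i ↔ i < plen b := by
  unfold double
  have := tail_le_plen hb hd i
  split_ifs with h <;> omega

lemma durfee_double (hb : IsPartition b) (hd : IsDistinct b) : durfee (double b) = plen b :=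
  eq_of_forall_lt_iff fun i => by
    rw [lt_durfee_iff (isPartition_double hb hd), lt_double_iff hb hd]

lemma double_injective {b' : ℕ → ℕ} (hb : IsPartition b) (hd : IsDistinct b)
    (hb' : IsPartition b') (hd' : IsDistinct b') (h : double b = double b') : b = b' := by
  have hlen : plen b = plen b' := by rw [← durfee_double hb hd, h, durfee_double hb' hd']
  funext i
  by_cases hi : i < plen b
  · have := congrFun h i
    unfold double at this
    rw [if_pos hi, if_pos (hlen ▸ hi)] at this
    omega
  · have h1 := mt (lt_plen_iff hb i).2 hi
    have h2 := mt (lt_plen_iff hb' i).2 (hlen ▸ hi)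
    omega

lemma pconj_double (hb : IsPartition b) (hd : IsDistinct b) {i : ℕ} (hi : i < plen b) :
    pconj (double b) i = b i + i := by
  refine eq_of_forall_lt_iff fun k => ?_
  rw [lt_pconj_iff (isPartition_double hb hd)]
  unfold double
  have h0 := (lt_plen_iff hb i).1 hi
  split_ifs with hk
  · have h1 := (lt_plen_iff hb k).1 hk
    rcases le_total k i with h | h
    · have := hd.add_le_add h h0
      omega
    · have := hd.add_le_add h h1
      omega
  · rw [lt_tail_iff hb hd]
    omega

lemma isDD_double (hb : IsPartition b) (hd : IsDistinct b) : IsDD (double b) := by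
  intro i hi
  rw [durfee_double hb hd] at hi
  rw [pconj_double hb hd hi]
  unfold double
  rw [if_pos hi]
  omega

/-- `double b` is a `g`-core as soon as neither the shifted hook lengths of `b` nor the numbers
`2 * b i` take the value `g`. -/
lemma isCore_double {g : ℕ} (hg : 0 < g) (hb : IsPartition b) (hd : IsDistinct b)
    (hh : g ∉ hooksAbove (double b)) (h2 : ∀ i, 2 * b i ≠ g) : IsCore g (double b) := by
  have hp := isPartition_double hb hd
  rw [isCore_iff hg hp]
  rw [mem_hooksAbove_iff hp] at hh
  push Not at hh
  have above : ∀ i < plen b, ∀ j, i < j →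
      (j : ℤ) - (pconj (double b) j : ℤ) ≠ (b i : ℤ) - g := by
    intro i hi j hij he
    have hdi : double b i = b i + (i + 1) := if_pos hi
    have hlt := lt_of_zero_gt_one hp (i := i) (j := j) (by omega)
    have := hookLen_eq hp hlt
    exact hh i j hij hlt (by omega)
  have hmem := mem_zeros_double_iff hb hd
  intro x hx
  by_contra hxg
  rcases (hmem x).1 hx with ⟨hpos, i, hi⟩ | ⟨hneg, hne⟩
  · have hi' := (lt_plen_iff hb i).2 (by omega)
    obtain ⟨j, hj⟩ := (notMem_zeros_iff hp _).1 hxg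
    rcases lt_trichotomy i j with hij | rfl | hij
    · exact above i hi' j hij (by omega)
    · have := pconj_double hb hd hi'
      have := h2 i
      omega
    · have h3 := pconj_double hb hd (show j < plen b by omega)
      have h4 := pconj_double hb hd hi'
      exact above j (by omega) i hij (by omega)
  · have : ∃ i, (b i : ℤ) = -(x - g) := by
      by_contra! h
      exact hxg ((hmem _).2 (Or.inr ⟨by omega, h⟩))
    obtain ⟨i, hi⟩ := this
    have hi' := (lt_plen_iff hb i).2 (by omega)
    have hnx : -x ∉ zeros (double b) := by
      rw [hmem]
      rintro (⟨-, k, hk⟩ | ⟨h, -⟩)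
      · exact hne k hk
      · omega
    obtain ⟨j, hj⟩ := (notMem_zeros_iff hp _).1 hnx
    refine above i hi' j ?_ (by omega)
    by_contra! hji
    have := pconj_double hb hd (show j < plen b by omega)
    omega

end Doubling

/-! ### The increasing bijection from `ℤ` onto the non-multiples of `n + 1` -/

/-- The increasing enumeration of the integers that are not multiples of `n + 1`. -/
def spread (n : ℕ) (x : ℤ) : ℤ := x + 1 + x / n

section Spread

variable {n : ℕ}

lemma spread_mul_add (q : ℤ) {r : ℤ} (h0 : 0 ≤ r) (h1 : r < n) :
    spread n (q * n + r) = q * (n + 1) + r + 1 := by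
  have : (q * n + r) / (n : ℤ) = q := by
    rw [add_comm, Int.add_mul_ediv_right _ _ (by omega), Int.ediv_eq_zero_of_lt h0 h1, zero_add]
  rw [spread, this]
  ring

lemma exists_eq_mul_add (hn : 0 < n) (x : ℤ) : ∃ q r : ℤ, 0 ≤ r ∧ r < n ∧ x = q * n + r :=
  ⟨x / n, x % n, Int.emod_nonneg _ (by omega), Int.emod_lt_of_pos _ (by omega),
    by linarith [Int.mul_ediv_add_emod x n]⟩

lemma spread_reflect (hn : 0 < n) (x : ℤ) : spread n (-1 - x) = -spread n x := by
  obtain ⟨q, r, h0, h1, rfl⟩ := exists_eq_mul_add hn x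
  rw [spread_mul_add q h0 h1, show -1 - (q * n + r) = (-1 - q) * (n : ℤ) + (n - 1 - r) by ring,
    spread_mul_add _ (by omega) (by omega)]
  ring

lemma spread_sub (hn : 0 < n) (x : ℤ) : spread n (x - 2 * n) = spread n x - (2 * n + 2) := by
  obtain ⟨q, r, h0, h1, rfl⟩ := exists_eq_mul_add hn x
  rw [spread_mul_add q h0 h1, show q * n + r - 2 * (n : ℤ) = (q - 2) * (n : ℤ) + r by ring,
    spread_mul_add _ h0 h1]
  ring

lemma spread_strictMono (hn : 0 < n) : StrictMono (spread n) := by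
  intro x y hxy
  have : x / (n : ℤ) ≤ y / n := Int.ediv_le_ediv (by omega) hxy.le
  unfold spread
  omega

lemma spread_pos {x : ℤ} (hx : 0 ≤ x) : 0 < spread n x := by
  have : 0 ≤ x / (n : ℤ) := Int.ediv_nonneg hx (by omega)
  unfold spread
  omega

lemma spread_neg (hn : 0 < n) {x : ℤ} (hx : x < 0) : spread n x < 0 := by
  have h1 := spread_reflect hn x
  have h2 := spread_pos (n := n) (x := -1 - x) (by omega)
  omega

lemma spread_ne_mul (hn : 0 < n) (x k : ℤ) : spread n x ≠ k * (n + 1) := by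
  obtain ⟨q, r, h0, h1, rfl⟩ := exists_eq_mul_add hn x
  rw [spread_mul_add q h0 h1]
  intro h
  have h2 : (k - q) * ((n : ℤ) + 1) = r + 1 := by linarith
  rcases le_or_gt (k - q) 0 with h3 | h3
  · nlinarith
  · nlinarith

lemma eq_mul_or_eq_spread (n : ℕ) (y : ℤ) :
    (∃ k : ℤ, y = k * (n + 1)) ∨ ∃ x, y = spread n x := by
  obtain ⟨q, r, h0, h1, rfl⟩ := exists_eq_mul_add (n := n + 1) (Nat.succ_pos n) y
  push_cast at h1 ⊢
  rcases h0.eq_or_lt with h | h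
  · exact Or.inl ⟨q, by rw [← h, add_zero]⟩
  · refine Or.inr ⟨q * n + (r - 1), ?_⟩
    rw [spread_mul_add q (by omega) (by omega)]
    ring

end Spread

/-! ### From self-conjugate cores to distinct partitions -/

/-- The distinct partition whose parts are the values of `spread n` at the nonnegative zeros of
the word of `c`. -/
def spreadParts (n : ℕ) (c : ℕ → ℕ) : ℕ → ℕ := fun i => (c i - i) + (c i - i - 1) / n

section SpreadParts

variable {n : ℕ} {c : ℕ → ℕ}

lemma spreadParts_eq_spread {i : ℕ} (hi : i < c i) :
    (spreadParts n c i : ℤ) = spread n ((c i : ℤ) - ((i : ℤ) + 1)) := by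
  have h : ((c i - i - 1 : ℕ) : ℤ) = (c i : ℤ) - ((i : ℤ) + 1) := by omega
  rw [spreadParts, spread, ← h]
  push_cast
  omega

lemma spreadParts_eq_zero {i : ℕ} (hi : c i ≤ i) : spreadParts n c i = 0 := by
  simp [spreadParts, Nat.sub_eq_zero_of_le hi]

lemma lt_of_spreadParts_ne_zero {i : ℕ} (h : spreadParts n c i ≠ 0) : i < c i := by
  by_contra! hi
  exact h (spreadParts_eq_zero hi)

lemma isPartition_spreadParts (hc : IsPartition c) : IsPartition (spreadParts n c) := by
  refine ⟨fun i j hij => ?_, ?_⟩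
  · have h := hc.1 hij
    exact Nat.add_le_add (by omega) (Nat.div_le_div_right (by omega))
  · obtain ⟨N, hN⟩ := hc.2
    exact ⟨N, fun i hi => spreadParts_eq_zero (by rw [hN i hi]; omega)⟩

lemma isDistinct_spreadParts (hc : IsPartition c) : IsDistinct (spreadParts n c) := by
  intro i hi
  have h1 := lt_of_spreadParts_ne_zero hi
  have h2 := hc.1 (Nat.le_succ i)
  rw [Nat.succ_eq_add_one] at h2
  exact Nat.add_lt_add_of_lt_of_le (by omega) (Nat.div_le_div_right (by omega))

lemma spreadParts_eq_iff {y : ℤ} (hy : 0 < y) :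
    (∃ i, (spreadParts n c i : ℤ) = y) ↔ ∃ x ∈ zeros c, 0 ≤ x ∧ spread n x = y := by
  constructor
  · rintro ⟨i, hi⟩
    have h := lt_of_spreadParts_ne_zero (n := n) (c := c) (i := i) (by omega)
    exact ⟨_, ⟨i, rfl⟩, by omega, by rw [← spreadParts_eq_spread h, hi]⟩
  · rintro ⟨x, ⟨i, rfl⟩, h0, hx⟩
    exact ⟨i, by rw [spreadParts_eq_spread (by omega), hx]⟩

lemma mul_mem_zeros_double_spreadParts_iff (hn : 0 < n) (hc : IsPartition c) (k : ℤ) :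
    k * (n + 1) ∈ zeros (double (spreadParts n c)) ↔ k < 0 := by
  have hn' : (0 : ℤ) < (n : ℤ) + 1 := by omega
  rw [mem_zeros_double_iff (isPartition_spreadParts hc) (isDistinct_spreadParts hc)]
  constructor
  · rintro (⟨hpos, h⟩ | ⟨hneg, -⟩)
    · obtain ⟨x, -, -, hx⟩ := (spreadParts_eq_iff hpos).1 h
      exact absurd hx (spread_ne_mul hn x k)
    · by_contra! hk
      nlinarith
  · intro hk
    have hneg : k * ((n : ℤ) + 1) < 0 := by nlinarith
    refine Or.inr ⟨hneg, fun i hi => ?_⟩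
    obtain ⟨x, -, -, hx⟩ := (spreadParts_eq_iff (n := n) (c := c) (neg_pos.2 hneg)).1 ⟨i, hi⟩
    exact spread_ne_mul hn x (-k) (by rw [hx]; ring)

lemma spread_mem_zeros_double_spreadParts_iff (hn : 0 < n) (hc : IsPartition c)
    (hs : SelfConj c) (x : ℤ) :
    spread n x ∈ zeros (double (spreadParts n c)) ↔ x ∈ zeros c := by
  rw [mem_zeros_double_iff (isPartition_spreadParts hc) (isDistinct_spreadParts hc)]
  have hinj := (spread_strictMono hn).injective
  rcases le_or_gt 0 x with hx | hx
  · have hpos := spread_pos (n := n) hx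
    rw [spreadParts_eq_iff hpos]
    constructor
    · rintro (⟨-, y, hy, -, he⟩ | ⟨h, -⟩)
      · rwa [← hinj he]
      · omega
    · exact fun h => Or.inl ⟨hpos, x, h, hx, rfl⟩
  · have hneg := spread_neg hn hx
    have hiff := spreadParts_eq_iff (n := n) (c := c) (neg_pos.2 hneg)
    rw [(selfConj_iff hc).1 hs x]
    constructor
    · rintro (⟨h, -⟩ | ⟨-, h⟩) hmem
      · omega
      · obtain ⟨i, hi⟩ := hiff.2 ⟨_, hmem, by omega, spread_reflect hn x⟩
        exact h i hi
    · refine fun h => Or.inr ⟨hneg, fun i hi => ?_⟩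
      obtain ⟨y, hy, -, he⟩ := hiff.1 ⟨i, hi⟩
      rw [← spread_reflect hn] at he
      exact h (hinj he ▸ hy)

lemma isCore_double_spreadParts (hn : 0 < n) (hc : IsPartition c) (hcore : IsCore (2 * n) c)
    (hs : SelfConj c) : IsCore (2 * n + 2) (double (spreadParts n c)) := by
  rw [isCore_iff (by omega)
    (isPartition_double (isPartition_spreadParts hc) (isDistinct_spreadParts hc))]
  rw [isCore_iff (by omega) hc] at hcore
  intro y hy
  push_cast
  rcases eq_mul_or_eq_spread n y with ⟨k, rfl⟩ | ⟨x, rfl⟩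
  · rw [mul_mem_zeros_double_spreadParts_iff hn hc] at hy
    rw [show k * ((n : ℤ) + 1) - (2 * n + 2) = (k - 2) * (n + 1) by ring,
      mul_mem_zeros_double_spreadParts_iff hn hc]
    omega
  · rw [spread_mem_zeros_double_spreadParts_iff hn hc hs] at hy
    rw [← spread_sub hn, spread_mem_zeros_double_spreadParts_iff hn hc hs]
    exact_mod_cast hcore x hy

lemma two_mul_spreadParts_ne (hn : 0 < n) (i : ℕ) :
    2 * spreadParts n c i ≠ 2 * n + 2 := by
  intro h
  obtain ⟨x, -, -, hx⟩ :=
    (spreadParts_eq_iff (n := n) (c := c) (y := (n : ℤ) + 1) (by omega)).1 ⟨i, by omega⟩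
  exact spread_ne_mul hn x 1 (by rw [hx]; ring)

lemma ncharge_double_spreadParts (hn : 0 < n) (hc : IsPartition c) (hcore : IsCore (2 * n) c)
    (hs : SelfConj c) {i : ℕ} (hi : i < 2 * n + 2) :
    ncharge (2 * n + 2) (double (spreadParts n c)) i = extVecD n (ncharge (2 * n) c) i := by
  refine ncharge_eq_of_forall fun k => ?_
  have hspread := spread_mem_zeros_double_spreadParts_iff hn hc hs
  have hmul := mul_mem_zeros_double_spreadParts_iff hn hc
  have hcharge := mem_zeros_iff_lt_ncharge (g := 2 * n) (by omega) hc hcore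
  unfold extVecD
  push_cast at hcharge ⊢
  split_ifs with h0 h1 h2 h3
  · rw [h0, show k * (2 * (n : ℤ) + 2) + ((0 : ℕ) : ℤ) = (2 * k) * (n + 1) by push_cast; ring,
      hmul]
    omega
  · have hi' : (i : ℤ) = ((i - 1 : ℕ) : ℤ) + 1 := by omega
    rw [← hcharge, ← hspread,
      show k * (2 * (n : ℤ)) + ((i - 1 : ℕ) : ℤ) = (2 * k) * n + ((i - 1 : ℕ) : ℤ) by ring,
      spread_mul_add _ (by omega) (by omega), hi']
    ring_nf
  · rw [h2, show k * (2 * (n : ℤ) + 2) + ((n + 1 : ℕ) : ℤ) = (2 * k + 1) * (n + 1) by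
      push_cast; ring, hmul]
    omega
  · have hrefl := ncharge_reflect hc hcore hs (i := 2 * n + 1 - i) (by omega)
    rw [show 2 * n - 1 - (2 * n + 1 - i) = i - 2 by omega] at hrefl
    have hi' : (i : ℤ) = ((i - (n + 2) : ℕ) : ℤ) + n + 2 := by omega
    have hi'' : ((i - 2 : ℕ) : ℤ) = ((i - (n + 2) : ℕ) : ℤ) + n := by omega
    rw [← hrefl, ← hcharge, ← hspread, hi'', hi',
      show k * (2 * (n : ℤ)) + (((i - (n + 2) : ℕ) : ℤ) + n) =
        (2 * k + 1) * n + ((i - (n + 2) : ℕ) : ℤ) by ring,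
      spread_mul_add _ (by omega) (by omega)]
    ring_nf
  · omega

end SpreadParts

/-! ### From distinct partitions back to self-conjugate cores -/

section Gather

variable {n : ℕ} {b : ℕ → ℕ}

lemma ne_mul_of_isCore_double (hb : IsPartition b) (hd : IsDistinct b)
    (hcore : IsCore (2 * n + 2) (double b)) (h2 : ∀ i, 2 * b i ≠ 2 * n + 2) (i : ℕ)
    (hi : b i ≠ 0) (k : ℤ) : (b i : ℤ) ≠ k * (n + 1) := by
  intro h
  have hp := isPartition_double hb hd
  have hmem := mem_zeros_double_iff hb hd
  have hk : 0 < k := by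
    by_contra! hk
    have : (0 : ℤ) < b i := by omega
    nlinarith
  have hx := hcore.sub_mul_mem (by omega) hp ((hmem (b i)).2 (Or.inl ⟨by omega, i, rfl⟩))
  have hx' := hx (k / 2).toNat
  rw [Int.toNat_of_nonneg (by omega), h] at hx'
  push_cast at hx'
  rcases Int.emod_two_eq_zero_or_one k with hk2 | hk2
  · rw [show k * ((n : ℤ) + 1) - k / 2 * (2 * n + 2) = (k - 2 * (k / 2)) * (n + 1) by ring,
      show k - 2 * (k / 2) = 0 by omega, zero_mul, hmem] at hx'
    omega
  · rw [show k * ((n : ℤ) + 1) - k / 2 * (2 * n + 2) = (k - 2 * (k / 2)) * (n + 1) by ring,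
      show k - 2 * (k / 2) = 1 by omega, one_mul, hmem] at hx'
    rcases hx' with ⟨-, j, hj⟩ | ⟨hneg, -⟩
    · exact h2 j (by omega)
    · omega

/-- Every distinct partition without parts divisible by `n + 1` is matched by a distinct
partition `a` along `x ↦ spread n (x - 1)`. -/
lemma exists_gather (hn : 0 < n) (hb : IsPartition b) (hd : IsDistinct b)
    (hne : ∀ i, b i ≠ 0 → ∀ k : ℤ, (b i : ℤ) ≠ k * (n + 1)) :
    ∃ a : ℕ → ℕ, IsPartition a ∧ IsDistinct a ∧
      ∀ i, (a i = 0 ↔ b i = 0) ∧ (b i ≠ 0 → (b i : ℤ) = spread n ((a i : ℤ) - 1)) := by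
  have hex : ∀ i, ∃ a : ℕ, (a = 0 ↔ b i = 0) ∧ (b i ≠ 0 → (b i : ℤ) = spread n ((a : ℤ) - 1)) := by
    intro i
    by_cases hi : b i = 0
    · exact ⟨0, by simp [hi], fun h => absurd hi h⟩
    · rcases eq_mul_or_eq_spread n (b i) with ⟨k, hk⟩ | ⟨x, hx⟩
      · exact absurd hk (hne i hi k)
      · have hx0 : 0 ≤ x := by
          by_contra! hneg
          have := spread_neg hn hneg
          omega
        refine ⟨(x + 1).toNat, by omega, fun _ => ?_⟩
        rw [hx]
        congr 1
        omega
  choose a ha using hex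
  have hmono := spread_strictMono hn
  refine ⟨a, ⟨antitone_nat_of_succ_le fun i => ?_, ?_⟩, fun i hi => ?_, ha⟩
  · by_cases h : b (i + 1) = 0
    · rw [(ha (i + 1)).1.2 h]
      exact Nat.zero_le _
    · have h1 := hd i h
      have h2 := (ha (i + 1)).2 h
      have h3 := (ha i).2 (by omega)
      have := hmono.lt_iff_lt.1 (show spread n ((a (i + 1) : ℤ) - 1) < spread n ((a i : ℤ) - 1) by
        omega)
      omega
  · obtain ⟨N, hN⟩ := hb.2
    exact ⟨N, fun i hi => (ha i).1.2 (hN i hi)⟩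
  · have h : b (i + 1) ≠ 0 := fun h => hi ((ha (i + 1)).1.2 h)
    have h1 := hd i h
    have h2 := (ha (i + 1)).2 h
    have h3 := (ha i).2 (by omega)
    have := hmono.lt_iff_lt.1 (show spread n ((a (i + 1) : ℤ) - 1) < spread n ((a i : ℤ) - 1) by
      omega)
    omega

lemma exists_selfConj_core (hn : 0 < n) (hb : IsPartition b) (hd : IsDistinct b)
    (hh : 2 * n + 2 ∉ hooksAbove (double b)) (h2 : ∀ i, 2 * b i ≠ 2 * n + 2) :
    ∃ c : ℕ → ℕ, IsPartition c ∧ IsCore (2 * n) c ∧ SelfConj c ∧ spreadParts n c = b := by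
  have hcore := isCore_double (by omega) hb hd hh h2
  have hne := ne_mul_of_isCore_double hb hd hcore h2
  obtain ⟨a, hap, had, ha⟩ := exists_gather hn hb hd hne
  have hc : IsPartition (scOf a) := isPartition_shiftDouble 0 hap had
  have hinj := (spread_strictMono hn).injective
  have hparts : ∀ x : ℤ, 0 ≤ x → ((∃ i, (a i : ℤ) = x + 1) ↔ ∃ i, (b i : ℤ) = spread n x) := by
    intro x hx
    have hpos := spread_pos (n := n) hx
    refine exists_congr fun i => ⟨fun h => ?_, fun h => ?_⟩
    · rw [(ha i).2 (fun h0 => by have := (ha i).1.2 h0; omega), h]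
      congr 1
      ring
    · have := hinj (((ha i).2 (by omega)).symm.trans h)
      omega
  have hself : SelfConj (scOf a) := by
    rw [selfConj_iff hc]
    intro x
    rw [mem_zeros_scOf_iff hap had, mem_zeros_scOf_iff hap had,
      show -1 - x + 1 = -x by ring, show -(-1 - x) = x + 1 by ring]
    rcases le_or_gt 0 x with hx | hx
    · constructor
      · rintro (⟨-, i, hi⟩ | ⟨h, -⟩) (⟨h', -⟩ | ⟨-, h'⟩)
        · omega
        · exact h' i hi
        · omega
        · omega
      · intro h
        by_contra! h'
        exact h (Or.inr ⟨by omega, h'.1 hx⟩)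
    · constructor
      · rintro (⟨h, -⟩ | ⟨-, h⟩) (⟨h', i, hi⟩ | ⟨h', -⟩)
        · omega
        · omega
        · exact h i hi
        · omega
      · intro h
        refine Or.inr ⟨hx, fun i hi => h (Or.inl ⟨by omega, i, hi⟩)⟩
  have hmem := mem_zeros_double_iff hb hd
  have hspread : ∀ x, spread n x ∈ zeros (double b) ↔ x ∈ zeros (scOf a) := by
    intro x
    rw [mem_zeros_scOf_iff hap had, hmem]
    rcases le_or_gt 0 x with hx | hx
    · have hpos := spread_pos (n := n) hx
      rw [hparts x hx]
      refine or_congr (by simp [hpos, hx]) (iff_of_false (by omega) (by omega))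
    · have hneg := spread_neg hn hx
      have h := not_congr (hparts (-1 - x) (by omega))
      rw [spread_reflect hn, show -1 - x + 1 = -x by ring] at h
      push Not at h
      rw [h]
      refine or_congr (iff_of_false (by omega) (by omega)) (by simp [hneg, hx])
  have hcore' : IsCore (2 * n) (scOf a) := by
    rw [isCore_iff (by omega) hc]
    rw [isCore_iff (by omega) (isPartition_double hb hd)] at hcore
    intro x hx
    rw [← hspread] at hx ⊢
    have := hcore _ hx
    push_cast at this ⊢
    rwa [spread_sub hn]
  refine ⟨scOf a, hc, hcore', hself, ?_⟩
  have hbs := isPartition_spreadParts (n := n) hc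
  have hds := isDistinct_spreadParts (n := n) hc
  refine double_injective hbs hds hb hd (zeros_injective (isPartition_double hbs hds)
    (isPartition_double hb hd) (Set.ext fun y => ?_))
  rcases eq_mul_or_eq_spread n y with ⟨k, rfl⟩ | ⟨x, rfl⟩
  · rw [mul_mem_zeros_double_spreadParts_iff hn hc, hmem]
    have hn' : (0 : ℤ) < (n : ℤ) + 1 := by omega
    constructor
    · intro hk
      have hneg : k * ((n : ℤ) + 1) < 0 := by nlinarith
      refine Or.inr ⟨hneg, fun i hi => hne i (by omega) (-k) (by rw [hi]; ring)⟩
    · rintro (⟨hpos, i, hi⟩ | ⟨hneg, -⟩)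
      · exact absurd hi (hne i (by omega) k)
      · by_contra! hk
        nlinarith
  · rw [spread_mem_zeros_double_spreadParts_iff hn hc hself, hspread]

end Gather

/-! ### Counting boxes -/

section Counting

variable {n : ℕ} {c : ℕ → ℕ}

lemma psize_eq_card_cells {p : ℕ → ℕ} (hp : IsPartition p) : psize p = (cells p).card := by
  have : (cells p).card = ((Finset.range (plen p)).sigma fun i => Finset.range (p i)).card := by
    refine Finset.card_bij' (fun s _ => ⟨s.1, s.2⟩) (fun s _ => (s.1, s.2)) ?_ ?_ ?_ ?_
    · intro s hs
      rw [mem_cells_iff hp] at hs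
      simp only [Finset.mem_sigma, Finset.mem_range, lt_plen_iff hp]
      omega
    · intro s hs
      simp only [Finset.mem_sigma, Finset.mem_range] at hs
      exact (mem_cells_iff hp _).2 hs.2
    · intro s _
      rfl
    · intro s _
      rfl
  rw [this, Finset.card_sigma, psize]
  simp

lemma card_cells_above (hc : IsPartition c) (P : ℤ → Prop) [DecidablePred P] (e : ℕ) :
    ((cells c).filter fun s => P ((s.2 : ℤ) - s.1) ∧ s.1 + e ≤ s.2).card =
      ∑ i ∈ Finset.range (durfee c),
        ((Finset.range (c i - i - e)).filter fun d : ℕ => P ((d + e : ℕ) : ℤ)).card := by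
  rw [← Finset.card_sigma]
  refine Finset.card_bij' (fun s _ => ⟨s.1, s.2 - s.1 - e⟩) (fun s _ => (s.1, s.1 + s.2 + e))
    ?_ ?_ ?_ ?_
  · rintro ⟨i, j⟩ hs
    simp only [Finset.mem_filter, mem_cells_iff hc] at hs
    obtain ⟨h1, h2, h3⟩ := hs
    simp only [Finset.mem_sigma, Finset.mem_range, Finset.mem_filter, lt_durfee_iff hc]
    refine ⟨by omega, by omega, ?_⟩
    convert h2 using 1
    omega
  · rintro ⟨i, d⟩ hs
    simp only [Finset.mem_sigma, Finset.mem_range, Finset.mem_filter, lt_durfee_iff hc] at hs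
    obtain ⟨h1, h2, h3⟩ := hs
    simp only [Finset.mem_filter, mem_cells_iff hc]
    refine ⟨by omega, ?_, by omega⟩
    convert h3 using 1
    push_cast
    ring
  · rintro ⟨i, j⟩ hs
    simp only [Finset.mem_filter] at hs
    simp only [Prod.mk.injEq, true_and]
    omega
  · rintro ⟨i, d⟩ hs
    simp only [Sigma.mk.injEq, heq_eq_eq, true_and]
    omega

/-- The boxes of a self-conjugate partition whose content satisfies an even predicate, counted
along the rows of the Durfee square. -/
lemma card_cells_filter (hc : IsPartition c) (hs : SelfConj c) (P : ℤ → Prop)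
    [DecidablePred P] (hP : ∀ d, P (-d) ↔ P d) :
    ((cells c).filter fun s => P ((s.2 : ℤ) - s.1)).card =
      ∑ i ∈ Finset.range (durfee c),
        (((Finset.range (c i - i)).filter fun d : ℕ => P (d : ℤ)).card +
          ((Finset.range (c i - i - 1)).filter fun d : ℕ => P ((d + 1 : ℕ) : ℤ)).card) := by
  have hsymm : ∀ i j, i < c j ↔ j < c i := fun i j => by
    rw [← lt_pconj_iff hc, ← hs]
  have hbelow : ((cells c).filter fun s => P ((s.2 : ℤ) - s.1) ∧ ¬ s.1 ≤ s.2).card =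
      ((cells c).filter fun s => P ((s.2 : ℤ) - s.1) ∧ s.1 + 1 ≤ s.2).card := by
    have hswap : ∀ s : ℕ × ℕ, P ((s.1 : ℤ) - s.2) ↔ P ((s.2 : ℤ) - s.1) := fun s => by
      rw [← hP, neg_sub]
    refine Finset.card_bij' (fun s _ => s.swap) (fun s _ => s.swap) ?_ ?_
      (fun _ _ => rfl) (fun _ _ => rfl)
    all_goals
      intro s hs'
      simp only [Finset.mem_filter, mem_cells_iff hc, Prod.fst_swap, Prod.snd_swap, hswap,
        hsymm s.1 s.2] at hs' ⊢
      exact ⟨hs'.1, hs'.2.1, by omega⟩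
  rw [← Finset.card_filter_add_card_filter_not (p := fun s : ℕ × ℕ => s.1 ≤ s.2),
    Finset.filter_filter, Finset.filter_filter, hbelow, card_cells_above hc P 1,
    Finset.sum_add_distrib]
  exact congrArg (· + _) (card_cells_above hc P 0)

lemma row_count (hn : 0 < n) (t : ℕ) :
    (t + 1) + t +
      (((Finset.range (t + 1)).filter fun d : ℕ => (d : ℤ) % (2 * n : ℕ) = (0 : ℕ)).card +
        ((Finset.range t).filter fun d : ℕ => ((d + 1 : ℕ) : ℤ) % (2 * n : ℕ) = (0 : ℕ)).card) +
      (((Finset.range (t + 1)).filter fun d : ℕ => (d : ℤ) % (2 * n : ℕ) = (n : ℕ)).card +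
        ((Finset.range t).filter fun d : ℕ => ((d + 1 : ℕ) : ℤ) % (2 * n : ℕ) = (n : ℕ)).card) =
      2 * (t + 1 + t / n) := by
  simp only [← Int.natCast_mod, Nat.cast_inj, Finset.card_filter]
  induction t with
  | zero =>
    rw [zero_add, Finset.sum_range_one, Finset.sum_range_zero, Finset.sum_range_one,
      Finset.sum_range_zero, Nat.zero_mod, Nat.zero_div, if_pos rfl, if_neg hn.ne]
    rfl
  | succ t ih =>
    rw [Finset.sum_range_succ (fun d => if d % (2 * n) = 0 then 1 else 0) (t + 1),
      Finset.sum_range_succ (fun d => if (d + 1) % (2 * n) = 0 then 1 else 0) t,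
      Finset.sum_range_succ (fun d => if d % (2 * n) = n then 1 else 0) (t + 1),
      Finset.sum_range_succ (fun d => if (d + 1) % (2 * n) = n then 1 else 0) t,
      Nat.succ_div]
    have hdvd : n ∣ t + 1 ↔ (t + 1) % (2 * n) = 0 ∨ (t + 1) % (2 * n) = n := by
      have hmod : (t + 1) % (2 * n) % n = (t + 1) % n := Nat.mod_mul_left_mod _ _ _
      have hlt := Nat.mod_lt (t + 1) (show 0 < 2 * n by omega)
      rw [Nat.dvd_iff_mod_eq_zero, ← hmod]
      generalize (t + 1) % (2 * n) = r at hlt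
      constructor
      · intro h
        obtain ⟨q, rfl⟩ := Nat.dvd_of_mod_eq_zero h
        have : q < 2 := by nlinarith
        interval_cases q <;> simp
      · rintro (rfl | rfl) <;> simp
    by_cases h0 : (t + 1) % (2 * n) = 0
    · have hne : (t + 1) % (2 * n) ≠ n := by omega
      rw [if_pos h0, if_neg hne, if_pos (hdvd.2 (Or.inl h0))]
      omega
    · by_cases h1 : (t + 1) % (2 * n) = n
      · rw [if_neg h0, if_pos h1, if_pos (hdvd.2 (Or.inr h1))]
        omega
      · rw [if_neg h0, if_neg h1, if_neg (fun h => (hdvd.1 h).elim h0 h1)]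
        omega

lemma plen_spreadParts (hc : IsPartition c) : plen (spreadParts n c) = durfee c :=
  eq_of_forall_lt_iff fun i => by
    rw [lt_plen_iff (isPartition_spreadParts hc), lt_durfee_iff hc]
    refine ⟨lt_of_spreadParts_ne_zero, fun h => ?_⟩
    exact (Nat.add_pos_left (by omega) _).ne'

lemma neg_emod_two_mul_eq_self (hn : 0 < n) {d : ℤ} (h : d % (2 * n : ℕ) = (n : ℕ)) :
    -d % (2 * n : ℕ) = (n : ℕ) := by
  have hd := Int.mul_ediv_add_emod d (2 * n : ℕ)
  rw [h] at hd
  rw [show -d = n + (2 * n : ℕ) * (-(d / (2 * n : ℕ)) - 1) by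
    nth_rw 1 [← hd]
    push_cast
    ring, Int.add_mul_emod_self_left, Int.emod_eq_of_lt (by omega) (by omega)]

lemma two_mul_psize_spreadParts (hn : 0 < n) (hc : IsPartition c) (hs : SelfConj c) :
    2 * psize (spreadParts n c) = psize c + resCount (2 * n) c 0 + resCount (2 * n) c n := by
  have hall := card_cells_filter hc hs (fun _ => True) (fun _ => Iff.rfl)
  have hzero := card_cells_filter hc hs (fun d => d % (2 * n : ℕ) = (0 : ℕ)) (fun d => by
    rw [Nat.cast_zero, EuclideanDomain.mod_eq_zero, EuclideanDomain.mod_eq_zero, dvd_neg])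
  have hmid := card_cells_filter hc hs (fun d => d % (2 * n : ℕ) = (n : ℕ)) (fun d =>
    ⟨fun h => neg_neg d ▸ neg_emod_two_mul_eq_self hn h, neg_emod_two_mul_eq_self hn⟩)
  simp only [Finset.filter_true, Finset.card_range] at hall
  rw [psize_eq_card_cells hc, resCount, resCount, hall, hzero, hmid, ← Finset.sum_add_distrib,
    ← Finset.sum_add_distrib, psize, plen_spreadParts hc, Finset.mul_sum]
  refine Finset.sum_congr rfl fun i hi => ?_
  rw [Finset.mem_range, lt_durfee_iff hc] at hi
  obtain ⟨t, ht⟩ : ∃ t, c i - i = t + 1 := ⟨c i - i - 1, by omega⟩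
  rw [spreadParts, ht, Nat.add_sub_cancel, ← row_count hn t]

/-! ### The size in terms of the charge -/

lemma sum_range_mul_add (g s : ℤ) (t : ℕ) :
    2 * ∑ k ∈ Finset.range t, ((k : ℤ) * g + s) = g * (t * (t - 1)) + 2 * s * t := by
  induction t with
  | zero => simp
  | succ t ih =>
    rw [Finset.sum_range_succ, mul_add, ih]
    push_cast
    ring

lemma psize_spreadParts_eq_sum_runners (hn : 0 < n) (hc : IsPartition c)
    (hcore : IsCore (2 * n) c) :
    (psize (spreadParts n c) : ℤ) = ∑ r ∈ Finset.range (2 * n),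
      ∑ k ∈ Finset.range (ncharge (2 * n) c r).toNat, spread n (k * (2 * n : ℕ) + r) := by
  have hcharge := mem_zeros_iff_lt_ncharge (g := 2 * n) (by omega) hc hcore
  rw [Finset.sum_sigma', psize, plen_spreadParts hc, Nat.cast_sum]
  have hdecomp : ∀ x : ℕ, (x : ℤ) = ((x / (2 * n) : ℕ) : ℤ) * (2 * n : ℕ) + (x % (2 * n) : ℕ) :=
    fun x => by exact_mod_cast (Nat.div_add_mod' x (2 * n)).symm
  have hrow : ∀ i < durfee c, (c i : ℤ) - ((i : ℤ) + 1) = ((c i - i - 1 : ℕ) : ℤ) := by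
    intro i hi
    rw [lt_durfee_iff hc] at hi
    omega
  refine Finset.sum_bij
    (fun i _ => ⟨(c i - i - 1) % (2 * n), (c i - i - 1) / (2 * n)⟩) ?_ ?_ ?_ ?_
  · intro i hi
    rw [Finset.mem_range] at hi
    have hlt : (((c i - i - 1) / (2 * n) : ℕ) : ℤ) <
        ncharge (2 * n) c ((c i - i - 1) % (2 * n)) := by
      rw [← hcharge, ← hdecomp, ← hrow i hi]
      exact ⟨i, rfl⟩
    simp only [Finset.mem_sigma, Finset.mem_range]
    exact ⟨Nat.mod_lt _ (by omega), by omega⟩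
  · intro i hi j hj hij
    simp only [Sigma.mk.injEq, heq_eq_eq] at hij
    have h : c i - i - 1 = c j - j - 1 := by
      rw [← Nat.div_add_mod (c i - i - 1) (2 * n), hij.1, hij.2, Nat.div_add_mod]
    rw [Finset.mem_range, lt_durfee_iff hc] at hi hj
    rcases le_total i j with hle | hle
    · have := hc.1 hle
      omega
    · have := hc.1 hle
      omega
  · rintro ⟨r, k⟩ hrk
    simp only [Finset.mem_sigma, Finset.mem_range] at hrk
    obtain ⟨i, hi⟩ := (hcharge r k).2 (by omega)
    have hx : c i - i - 1 = k * (2 * n) + r ∧ i < c i := by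
      have : (k : ℤ) * (2 * n : ℕ) + r = ((k * (2 * n) + r : ℕ) : ℤ) := by push_cast; ring
      omega
    refine ⟨i, Finset.mem_range.2 ((lt_durfee_iff hc i).2 hx.2), ?_⟩
    rw [hx.1, Nat.mul_add_mod', Nat.mod_eq_of_lt hrk.1, add_comm,
      Nat.add_mul_div_right _ _ (by omega), Nat.div_eq_of_lt hrk.1, zero_add]
  · intro i hi
    rw [Finset.mem_range] at hi
    rw [spreadParts_eq_spread ((lt_durfee_iff hc i).1 hi), hrow i hi]
    exact congrArg _ (hdecomp _)

lemma psize_spreadParts (hn : 0 < n) (hc : IsPartition c) (hcore : IsCore (2 * n) c)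
    (hs : SelfConj c) :
    (psize (spreadParts n c) : ℤ) =
      ((n : ℤ) + 1) * ∑ i ∈ Finset.range n, (ncharge (2 * n) c i) ^ 2
        + ∑ i ∈ Finset.range n, ((i : ℤ) - (n : ℤ)) * ncharge (2 * n) c i := by
  rw [psize_spreadParts_eq_sum_runners hn hc hcore, two_mul n, Finset.sum_range_add,
    ← Finset.sum_range_reflect (fun r => ∑ k ∈ Finset.range (ncharge (n + n) c (n + r)).toNat, _),
    ← Finset.sum_add_distrib, Finset.mul_sum, ← Finset.sum_add_distrib]
  refine Finset.sum_congr rfl fun i hi => ?_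
  rw [Finset.mem_range] at hi
  have hrefl := ncharge_reflect hc hcore hs (i := i) (by omega)
  rw [two_mul n, show n + n - 1 - i = n + (n - 1 - i) by omega] at hrefl
  rw [hrefl]
  have h1 : ∀ k : ℕ, spread n ((k : ℤ) * (n + n : ℕ) + i) = k * (2 * n + 2) + (i + 1) := by
    intro k
    rw [show (k : ℤ) * (n + n : ℕ) + i = (2 * k) * n + i by push_cast; ring,
      spread_mul_add _ (by omega) (by omega)]
    ring
  have h2 : ∀ k : ℕ, spread n ((k : ℤ) * (n + n : ℕ) + (n + (n - 1 - i) : ℕ)) =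
      k * (2 * n + 2) + (2 * n + 1 - i) := by
    intro k
    rw [show (k : ℤ) * (n + n : ℕ) + (n + (n - 1 - i) : ℕ) =
      (2 * k + 1) * n + (n - 1 - i : ℕ) by push_cast; ring,
      spread_mul_add _ (by omega) (by omega), show ((n - 1 - i : ℕ) : ℤ) = n - 1 - i by omega]
    ring
  simp only [h1, h2]
  generalize ncharge (n + n) c i = m
  have h3 := sum_range_mul_add (2 * n + 2) (i + 1) m.toNat
  have h4 := sum_range_mul_add (2 * n + 2) (2 * n + 1 - i) (-m).toNat
  rcases le_total 0 m with hm | hm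
  · rw [Int.toNat_of_nonneg hm] at h3
    rw [Int.toNat_of_nonpos (show -m ≤ 0 by omega)] at h4 ⊢
    simp only [Finset.range_zero, Finset.sum_empty, add_zero]
    linarith
  · rw [Int.toNat_of_nonneg (show 0 ≤ -m by omega)] at h4
    rw [Int.toNat_of_nonpos hm] at h3 ⊢
    simp only [Finset.range_zero, Finset.sum_empty, zero_add]
    linarith

end Counting

/-- Let `c` be a self-conjugate `2n`-core with
`φ_{2n}(c) = (m_0, …, m_{n-1}, -m_{n-1}, …, -m_0)` and let
`c' = φ_{2n+2}^{-1}(0, m_0, …, m_{n-1}, 0, -m_{n-1}, …, -m_0)`.  Then `c'` is a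
doubled distinct `(2n+2)`-core, there is a unique distinct partition
`λ̄ ∈ 𝒞_{2n+2}^{d,r}` with `c' = λ̄λ̄`, the resulting map `c ↦ λ̄` is a bijection
from `𝒞_{2n}^s` onto `𝒞_{2n+2}^{d,r}`, and
`|λ̄| = (n+1) ∑_{i<n} m_i² + ∑_{i<n} (i - n) m_i = (1/2)(|c| + a_0(c) + a_n(c))`. -/
theorem type_D_n_plus_one_2_atomic_length (n : ℕ) (hn : 2 ≤ n) :
    (∀ c c' : ℕ → ℕ, IsPartition c → IsCore (2 * n) c → SelfConj c →
      IsPartition c' → IsCore (2 * n + 2) c' →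
      (∀ i < 2 * n + 2, ncharge (2 * n + 2) c' i = extVecD n (ncharge (2 * n) c) i) →
      (IsDD c' ∧
       (∃! b : ℕ → ℕ, IsPartition b ∧ IsDistinct b ∧
          ((2 * n + 2) ∉ hooksAbove (double b) ∧ ∀ i, 2 * b i ≠ 2 * n + 2) ∧
          double b = c') ∧
       (∀ b : ℕ → ℕ, IsPartition b → IsDistinct b → double b = c' →
         ((psize b : ℤ) =
             ((n : ℤ) + 1) * ∑ i ∈ Finset.range n, (ncharge (2 * n) c i) ^ 2
               + ∑ i ∈ Finset.range n, ((i : ℤ) - (n : ℤ)) * ncharge (2 * n) c i ∧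
          2 * (psize b : ℤ) =
            (psize c : ℤ) + (resCount (2 * n) c 0 : ℤ) + (resCount (2 * n) c n : ℤ))))) ∧
    (∃ F : {c : ℕ → ℕ // IsPartition c ∧ IsCore (2 * n) c ∧ SelfConj c} →
          {b : ℕ → ℕ // IsPartition b ∧ IsDistinct b ∧
            (2 * n + 2) ∉ hooksAbove (double b) ∧ ∀ i, 2 * b i ≠ 2 * n + 2},
      Function.Bijective F ∧
      ∀ c, ∀ i < 2 * n + 2,
        ncharge (2 * n + 2) (double (F c).1) i = extVecD n (ncharge (2 * n) c.1) i) := by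
  have hn0 : 0 < n := by omega
  refine ⟨fun c c' hc hcore hs hc' hcore' hch => ?_, ?_⟩
  · have hb := isPartition_spreadParts (n := n) hc
    have hd := isDistinct_spreadParts (n := n) hc
    have hdouble := isCore_double_spreadParts hn0 hc hcore hs
    have heq : double (spreadParts n c) = c' :=
      eq_of_ncharge_eq (by omega) (isPartition_double hb hd) hc' hdouble hcore' fun i hi => by
        rw [ncharge_double_spreadParts hn0 hc hcore hs hi, hch i hi]
    subst heq
    refine ⟨isDD_double hb hd, ⟨spreadParts n c, ⟨hb, hd, ⟨hdouble.notMem_hooksAbove,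
      two_mul_spreadParts_ne hn0⟩, rfl⟩, fun b h => double_injective h.1 h.2.1 hb hd h.2.2.2⟩,
      fun b hb' hd' hbb => ?_⟩
    rw [double_injective hb' hd' hb hd hbb]
    exact ⟨psize_spreadParts hn0 hc hcore hs, by
      exact_mod_cast two_mul_psize_spreadParts hn0 hc hs⟩
  · refine ⟨fun c => ⟨spreadParts n c.1, isPartition_spreadParts c.2.1,
      isDistinct_spreadParts c.2.1,
      (isCore_double_spreadParts hn0 c.2.1 c.2.2.1 c.2.2.2).notMem_hooksAbove,
      two_mul_spreadParts_ne hn0⟩, ⟨?_, ?_⟩,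
      fun c i hi => ncharge_double_spreadParts hn0 c.2.1 c.2.2.1 c.2.2.2 hi⟩
    · rintro ⟨c₁, hp₁, _, hs₁⟩ ⟨c₂, hp₂, _, hs₂⟩ h
      have heq : spreadParts n c₁ = spreadParts n c₂ := congrArg Subtype.val h
      refine Subtype.ext (zeros_injective hp₁ hp₂ (Set.ext fun x => ?_))
      rw [← spread_mem_zeros_double_spreadParts_iff hn0 hp₁ hs₁, heq,
        spread_mem_zeros_double_spreadParts_iff hn0 hp₂ hs₂]
    · rintro ⟨b, hb, hd, hh, h2⟩
      obtain ⟨c, hc, hcore, hs, hcb⟩ := exists_selfConj_core hn0 hb hd hh h2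
      exact ⟨⟨c, hc, hcore, hs⟩, Subtype.ext hcb⟩
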